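/- With Ē_{k,i}(N) and Γ̄_{k,i}(N) as defined (generating functions of paths with N peaks satisfying the special (k,i)-conditions, and of such paths with the first North-East step deleted), one has Ē_{k,i}(N) = a^N q^{N(N+1)/2} (−1/a;q)_N Σ_{n=−N}^{N} (−1)^n q^{kn² + n(k−i) − n(n−1)/2} / ((q;q)_{N−n} (q;q)_{N+n}) and Γ̄_{k,i}(N) = a^N q^{N(N−1)/2} (−1/a;q)_N Σ_{n=−N}^{N−1} (−1)^n q^{kn² + n(k−i) − n(n+1)/2} / ((q;q)_{N−n−1} (q;q)_{N+n}). -/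

import Mathlib

namespace Paper

/-- The four kinds of unitary steps. -/
inductive PStep : Type
  | NE | SE | S | E
  deriving DecidableEq, BEq, Repr

/-- Horizontal displacement of a step. -/
def stepDx : PStep → ℕ
  | .S => 0
  | _ => 1

/-- Vertical displacement of a step. -/
def stepDy : PStep → ℤ
  | .NE => 1
  | .SE => -1
  | .S => -1
  | .E => 0

/-- Height (`y`-coordinate) after performing the steps of `l`, starting at height `h`. -/
def pathHeight (h : ℕ) (l : List PStep) : ℤ := (h : ℤ) + (l.map stepDy).sum

/-- `x`-coordinate after performing the steps of `l`, starting on the `y`-axis. -/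
def pathX (l : List PStep) : ℕ := (l.map stepDx).sum

/-- A valid path: stays in the first quadrant, starts at `(0,h)` on the `y`-axis, ends
on the `x`-axis, South steps only appear directly after a North-East step, East steps
only appear at height `0`, and the path is empty or ends with a South-East or South step. -/
def ValidPath (h : ℕ) (l : List PStep) : Prop :=
  (∀ m : ℕ, 0 ≤ pathHeight h (l.take m)) ∧
  (∀ m : ℕ, l[m]? = some PStep.S → ∃ m', m = m' + 1 ∧ l[m']? = some PStep.NE) ∧
  (∀ m : ℕ, l[m]? = some PStep.E → pathHeight h (l.take m) = 0) ∧
  pathHeight h l = 0 ∧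
  (l = [] ∨ l.getLast? = some PStep.SE ∨ l.getLast? = some PStep.S)

/-- The vertex reached after step `m` is a peak: it is preceded by a North-East step and
followed by a South-East step (NESE peak) or a South step (NES peak). -/
def IsPeak (l : List PStep) (m : ℕ) : Prop :=
  l[m]? = some PStep.NE ∧ (l[m+1]? = some PStep.SE ∨ l[m+1]? = some PStep.S)

instance (l : List PStep) (m : ℕ) : Decidable (IsPeak l m) := by
  unfold IsPeak; infer_instance

/-- The major index of a path: the sum of the `x`-coordinates of its peaks. -/
def majorIndex (l : List PStep) : ℕ :=
  ∑ m ∈ Finset.range l.length, if IsPeak l m then pathX (l.take (m + 1)) else 0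

/-- The number of peaks of a path. -/
def numPeaks (l : List PStep) : ℕ :=
  ((Finset.range l.length).filter fun m => IsPeak l m).card

/-- The number of South steps of a path. -/
def southSteps (l : List PStep) : ℕ := l.count PStep.S

/-- A path satisfies the special `(k,i)`-conditions if it is a valid path starting at
height `k - i` whose height always stays below `k`. -/
def SpecialPath (k i : ℕ) (l : List PStep) : Prop :=
  ValidPath (k - i) l ∧ ∀ m : ℕ, pathHeight (k - i) (l.take m) < k

/-- `Ebar k i n j` is the number of paths with major index `n` and `j` South steps
satisfying the special `(k,i)`-conditions. -/
noncomputable def Ebar (k i n j : ℕ) : ℕ :=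
  Nat.card {l : List PStep // SpecialPath k i l ∧ majorIndex l = n ∧ southSteps l = j}


open scoped Classical

/-- The infinite q-Pochhammer symbol `(x;q)_∞ = ∏_{i≥0} (1 - x qⁱ)`. -/
noncomputable def qPochInf (x q : ℂ) : ℂ := ∏' i : ℕ, (1 - x * q ^ i)

/-- The finite q-Pochhammer symbol `(x;q)_N = ∏_{i=0}^{N-1} (1 - x qⁱ)`. -/
noncomputable def qPochN (x q : ℂ) (N : ℕ) : ℂ := ∏ i ∈ Finset.range N, (1 - x * q ^ i)

/-- The q-Pochhammer symbol with arbitrary integer index,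
`(x;q)_n = (x;q)_∞ / (x qⁿ;q)_∞`. -/
noncomputable def qPochZ (x q : ℂ) (n : ℤ) : ℂ := qPochInf x q / qPochInf (x * q ^ n) q


/-- The number of paths with major index `n`, `j` South steps and `N` peaks satisfying
the special `(k,i)`-conditions. -/
noncomputable def EbarP (k i n j N : ℕ) : ℕ :=
  Nat.card {l : List PStep // SpecialPath k i l ∧ majorIndex l = n ∧
    southSteps l = j ∧ numPeaks l = N}

/-- The number of objects (with major index `n`, `j` South steps, `N` peaks) obtained
by deleting the first North-East step of a path counted in `Ē_{k,i+1}(N)` that begins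
with a North-East step.  Deleting the initial North-East step decreases the major
index by `N`. -/
noncomputable def GbarP (k i n j N : ℕ) : ℕ :=
  Nat.card {l : List PStep // SpecialPath k (i + 1) l ∧ numPeaks l = N ∧
    l.head? = some PStep.NE ∧ majorIndex l = n + N ∧ southSteps l = j}

section Recursion

/-- `Walk k p h l`: the steps `l`, performed from height `h` after a last step `p`
(`none` at the start of a path), complete a path staying strictly below height `k`. -/
def Walk (k : ℕ) : Option PStep → ℤ → List PStep → Prop
  | p, h, [] => h = 0 ∧ 0 < k ∧ p ≠ some .NE ∧ p ≠ some .E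
  | p, h, s :: l => 0 ≤ h ∧ h < k ∧ (s = .S → p = some .NE) ∧ (s = .E → h = 0) ∧
      Walk k (some s) (h + stepDy s) l

lemma forall_nat_iff {p : ℕ → Prop} : (∀ m, p m) ↔ p 0 ∧ ∀ m, p (m + 1) :=
  ⟨fun H => ⟨H 0, fun m => H (m + 1)⟩, fun H m => m.casesOn H.1 H.2⟩

lemma exists_pred_iff {p : ℕ → Prop} (m : ℕ) :
    (∃ m', m + 1 = m' + 1 ∧ p m') ↔ p m :=
  ⟨by rintro ⟨m', h, hp⟩; obtain rfl : m = m' := by omega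
      exact hp, fun h => ⟨m, rfl, h⟩⟩

lemma walk_iff (k : ℕ) (p : Option PStep) (h : ℤ) (l : List PStep) :
    Walk k p h l ↔
      (∀ m, 0 ≤ h + ((l.take m).map stepDy).sum) ∧
      (∀ m, h + ((l.take m).map stepDy).sum < k) ∧
      ((l[0]? = some .S → p = some .NE) ∧
        ∀ m : ℕ, l[m + 1]? = some PStep.S → l[m]? = some PStep.NE) ∧
      (∀ m : ℕ, l[m]? = some PStep.E → h + ((l.take m).map stepDy).sum = 0) ∧
      h + (l.map stepDy).sum = 0 ∧
      (l.getLast?.or p ≠ some .NE ∧ l.getLast?.or p ≠ some .E) := by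
  induction l generalizing p h with
  | nil =>
    simp [Walk]
    constructor
    · rintro ⟨rfl, hk, h1, h2⟩
      simp [hk, h1, h2]
    · rintro ⟨-, hk, rfl, h1, h2⟩
      exact ⟨rfl, by exact_mod_cast hk, h1, h2⟩
  | cons s l ih =>
    rw [Walk, ih]
    rw [forall_nat_iff (p := fun m => 0 ≤ h + (((s :: l).take m).map stepDy).sum),
      forall_nat_iff (p := fun m => h + (((s :: l).take m).map stepDy).sum < k),
      forall_nat_iff (p := fun m : ℕ => (s :: l)[m + 1]? = some PStep.S → _),
      forall_nat_iff (p := fun m : ℕ => (s :: l)[m]? = some PStep.E → _)]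
    have hl : (s :: l).getLast?.or p = l.getLast?.or (some s) := by
      rw [List.getLast?_cons]; cases l.getLast? <;> simp
    rw [hl]
    simp [← add_assoc]
    tauto

lemma walk_of_ne_NE {k : ℕ} {p : Option PStep} {h : ℤ} {l : List PStep}
    (hp : p = some .SE ∨ p = some .S) : Walk k p h l ↔ Walk k none h l := by
  rcases hp with rfl | rfl <;> cases l <;> simp [Walk]

lemma specialPath_iff {k i : ℕ} {l : List PStep} :
    SpecialPath k i l ↔ Walk k none (k - i : ℕ) l := by
  rw [walk_iff]
  unfold SpecialPath ValidPath
  rw [forall_nat_iff (p := fun m => l[m]? = some PStep.S → _)]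
  simp only [exists_pred_iff]
  have hlast : (l = [] ∨ l.getLast? = some .SE ∨ l.getLast? = some .S) ↔
      (l.getLast?.or none ≠ some .NE ∧ l.getLast?.or none ≠ some .E) := by
    rcases h : l.getLast? with _ | s
    · simpa using h
    · have : l ≠ [] := by rintro rfl; simp at h
      cases s <;> simp [this]
  rw [hlast]
  simp only [pathHeight]
  simp
  tauto

lemma exists_cons_of_walk_NE {k : ℕ} {p : Option PStep} {h : ℤ} {l : List PStep}
    (H : Walk k p h (.NE :: l)) : ∃ s l', l = s :: l' ∧ s ≠ .E := by
  rcases l with _ | ⟨s, l⟩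
  · simp [Walk] at H
  · refine ⟨s, l, rfl, ?_⟩
    rintro rfl
    simp [Walk, stepDy] at H
    omega

lemma numPeaks_cons (s : PStep) (l : List PStep) :
    numPeaks (s :: l) = (if IsPeak (s :: l) 0 then 1 else 0) + numPeaks l := by
  simp only [numPeaks, Finset.card_filter, List.length_cons]
  rw [Finset.sum_range_succ', add_comm]
  rfl

lemma majorIndex_cons (s : PStep) (l : List PStep) :
    majorIndex (s :: l) = (if IsPeak (s :: l) 0 then stepDx s else 0) +
      (majorIndex l + stepDx s * numPeaks l) := by
  simp only [majorIndex, numPeaks, Finset.card_filter, List.length_cons]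
  rw [Finset.sum_range_succ', add_comm, Finset.mul_sum, ← Finset.sum_add_distrib]
  congr 1
  refine Finset.sum_congr rfl fun m _ => ?_
  have : IsPeak (s :: l) (m + 1) ↔ IsPeak l m := by simp [IsPeak]
  simp only [this]
  split_ifs <;> simp [pathX]
  ring

lemma southSteps_cons (s : PStep) (l : List PStep) :
    southSteps (s :: l) = southSteps l + if s = .S then 1 else 0 := by
  rw [southSteps, southSteps, List.count_cons]
  cases s <;> rfl

lemma numPeaks_pos {k : ℕ} {p : Option PStep} {h : ℤ} {l : List PStep}
    (H : Walk k p h (.NE :: l)) : 0 < numPeaks (.NE :: l) := by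
  induction l generalizing p h with
  | nil => simp [Walk] at H
  | cons s l ih =>
    rw [numPeaks_cons]
    cases s
    · have := ih H.2.2.2.2
      omega
    · simp [IsPeak]
    · simp [IsPeak]
    · obtain ⟨s, l', h, h'⟩ := exists_cons_of_walk_NE H
      simp at h
      exact absurd h.1.symm h'

lemma numPeaks_le_majorIndex (l : List PStep) :
    numPeaks (.NE :: l) ≤ majorIndex (.NE :: l) := by
  rw [numPeaks_cons, majorIndex_cons]
  simp only [stepDx]
  omega

end Recursion

section Decomposition

/-- Paths with `N` peaks starting at height `h` and staying strictly below `k`. -/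
def pathsWithPeaks (k h N : ℕ) : Set (List PStep) :=
  {l | Walk k none h l ∧ numPeaks l = N}

/-- Paths in `pathsWithPeaks k h N` beginning with a North-East step. -/
def risingPaths (k h N : ℕ) : Set (List PStep) :=
  {l | l ∈ pathsWithPeaks k h N ∧ l.head? = some .NE}

lemma risingPaths_zero (k h : ℕ) : risingPaths k h 0 = ∅ := by
  ext l
  simp only [risingPaths, pathsWithPeaks, Set.mem_ofPred_eq, Set.mem_empty_iff_false, iff_false]
  rintro ⟨⟨H, hN⟩, hl⟩
  rcases l with _ | ⟨s, l⟩
  · simp at hl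
  · obtain rfl : s = .NE := by simpa using hl
    have := numPeaks_pos H
    omega

lemma risingPaths_top (k N : ℕ) : risingPaths (k + 1) k N = ∅ := by
  ext l
  simp only [risingPaths, pathsWithPeaks, Set.mem_ofPred_eq, Set.mem_empty_iff_false, iff_false]
  rintro ⟨⟨H, hN⟩, hl⟩
  rcases l with _ | ⟨s, l⟩
  · simp at hl
  · obtain rfl : s = .NE := by simpa using hl
    obtain ⟨s, l', rfl, -⟩ := exists_cons_of_walk_NE H
    simp [Walk, stepDy] at H

lemma risingPaths_succ {k h N : ℕ} (hk : h + 1 < k) :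
    risingPaths k h (N + 1) = (List.cons .NE '' risingPaths k (h + 1) (N + 1) ∪
      (fun l => .NE :: .SE :: l) '' pathsWithPeaks k h N) ∪
        (fun l => .NE :: .S :: l) '' pathsWithPeaks k h N := by
  have hk' : (h : ℤ) + 1 < k := by exact_mod_cast hk
  have hk'' : (h : ℤ) < k := by linarith
  have h0 : (0 : ℤ) ≤ h + 1 := by positivity
  ext l
  simp only [risingPaths, pathsWithPeaks, Set.mem_ofPred_eq, Set.mem_union, Set.mem_image]
  constructor
  · rintro ⟨⟨H, hN⟩, hl⟩
    rcases l with _ | ⟨s, l⟩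
    · simp at hl
    obtain rfl : s = .NE := by simpa using hl
    obtain ⟨s, l, rfl, hs⟩ := exists_cons_of_walk_NE H
    cases s
    · refine Or.inl (Or.inl ⟨.NE :: l, ⟨⟨?_, ?_⟩, rfl⟩, rfl⟩)
      · simpa [Walk, stepDy, hk', hk'', h0] using H
      · simpa [numPeaks_cons _ (.NE :: l), IsPeak] using hN
    · refine Or.inl (Or.inr ⟨l, ⟨?_, ?_⟩, rfl⟩)
      · simpa [Walk, stepDy, hk', hk'', h0, walk_of_ne_NE] using H
      · simpa [numPeaks_cons, IsPeak, add_comm 1 (numPeaks l)] using hN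
    · refine Or.inr ⟨l, ⟨?_, ?_⟩, rfl⟩
      · simpa [Walk, stepDy, hk', hk'', h0, walk_of_ne_NE] using H
      · simpa [numPeaks_cons, IsPeak, add_comm 1 (numPeaks l)] using hN
    · exact absurd rfl hs
  · rintro ((⟨l, ⟨⟨H, hN⟩, hl⟩, rfl⟩ | ⟨l, ⟨H, hN⟩, rfl⟩) | ⟨l, ⟨H, hN⟩, rfl⟩)
    · rcases l with _ | ⟨s, l⟩
      · simp at hl
      obtain rfl : s = .NE := by simpa using hl
      refine ⟨⟨?_, ?_⟩, rfl⟩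
      · simpa [Walk, stepDy, hk', hk'', h0] using H
      · simpa [numPeaks_cons _ (.NE :: l), IsPeak] using hN
    · refine ⟨⟨?_, ?_⟩, rfl⟩
      · simpa [Walk, stepDy, hk', hk'', h0, walk_of_ne_NE] using H
      · simpa [numPeaks_cons, IsPeak, add_comm 1 (numPeaks l)] using hN
    · refine ⟨⟨?_, ?_⟩, rfl⟩
      · simpa [Walk, stepDy, hk', hk'', h0, walk_of_ne_NE] using H
      · simpa [numPeaks_cons, IsPeak, add_comm 1 (numPeaks l)] using hN

lemma pathsWithPeaks_succ {k h N : ℕ} (hk : h + 1 < k) :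
    pathsWithPeaks k (h + 1) N =
      List.cons .SE '' pathsWithPeaks k h N ∪ risingPaths k (h + 1) N := by
  have hk' : (h : ℤ) + 1 < k := by exact_mod_cast hk
  have h0 : (0 : ℤ) ≤ h + 1 := by positivity
  have h1 : (h : ℤ) + 1 ≠ 0 := by positivity
  ext l
  simp only [risingPaths, pathsWithPeaks, Set.mem_ofPred_eq, Set.mem_union, Set.mem_image]
  constructor
  · rintro ⟨H, hN⟩
    rcases l with _ | ⟨s, l⟩
    · simp [Walk, h1] at H
    cases s
    · exact Or.inr ⟨⟨H, hN⟩, rfl⟩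
    · refine Or.inl ⟨l, ⟨?_, ?_⟩, rfl⟩
      · simpa [Walk, stepDy, hk', h0, walk_of_ne_NE] using H
      · simpa [numPeaks_cons, IsPeak] using hN
    · simp [Walk] at H
    · simp [Walk, h1] at H
  · rintro (⟨l, ⟨H, hN⟩, rfl⟩ | H)
    · refine ⟨?_, ?_⟩
      · simpa [Walk, stepDy, hk', h0, walk_of_ne_NE] using H
      · simpa [numPeaks_cons, IsPeak] using hN
    · exact H.1

lemma walk_E {k : ℕ} {l : List PStep} :
    Walk k none 0 (.E :: l) ↔ l ≠ [] ∧ Walk k none 0 l := by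
  rcases l with _ | ⟨s, l⟩ <;> simp [Walk, stepDy]

lemma walk_zero_cases {k : ℕ} {s : PStep} {l : List PStep} (H : Walk k none 0 (s :: l)) :
    s = .NE ∨ s = .E := by
  cases s
  · exact Or.inl rfl
  · cases l <;> simp [Walk, stepDy] at H
  · simp [Walk] at H
  · exact Or.inr rfl

lemma numPeaks_E (l : List PStep) : numPeaks (.E :: l) = numPeaks l := by
  simp [numPeaks_cons, IsPeak]

lemma exists_replicate_E {k : ℕ} {l : List PStep} (hl : l ≠ []) (H : Walk k none 0 l) :
    ∃ m l', l = List.replicate m .E ++ l' ∧ Walk k none 0 l' ∧ l'.head? = some .NE := by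
  induction l with
  | nil => exact absurd rfl hl
  | cons s l ih =>
    rcases walk_zero_cases H with rfl | rfl
    · exact ⟨0, _, rfl, H, rfl⟩
    · obtain ⟨h1, h2⟩ := walk_E.1 H
      obtain ⟨m, l', rfl, h⟩ := ih h1 h2
      exact ⟨m + 1, l', rfl, h⟩

lemma walk_replicate_E {k m : ℕ} {l : List PStep} (hl : l ≠ []) :
    Walk k none 0 (List.replicate m .E ++ l) ↔ Walk k none 0 l := by
  induction m with
  | zero => rfl
  | succ m ih => simp [List.replicate_succ, walk_E, ih, hl]

lemma numPeaks_replicate_E (m : ℕ) (l : List PStep) :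
    numPeaks (List.replicate m .E ++ l) = numPeaks l := by
  induction m with
  | zero => rfl
  | succ m ih => rw [List.replicate_succ, List.cons_append, numPeaks_E, ih]

lemma pathsWithPeaks_zero_zero {k : ℕ} (hk : 0 < k) : pathsWithPeaks k 0 0 = {[]} := by
  ext l
  simp only [pathsWithPeaks, Set.mem_ofPred_eq, Set.mem_singleton_iff]
  constructor
  · rintro ⟨H, hN⟩
    by_contra hl
    obtain ⟨m, l', rfl, h1, h2⟩ := exists_replicate_E hl H
    rw [numPeaks_replicate_E] at hN
    have : l' ∈ risingPaths k 0 0 := ⟨⟨h1, hN⟩, h2⟩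
    simp [risingPaths_zero] at this
  · rintro rfl
    simpa [Walk, numPeaks] using hk

lemma ne_nil_of_mem_risingPaths {k h N : ℕ} {l : List PStep} (hl : l ∈ risingPaths k h N) :
    l ≠ [] := by
  rintro rfl
  simpa using hl.2

lemma replicate_E_append_injective {m m' : ℕ} {l l' : List PStep}
    (hl : l.head? = some .NE) (hl' : l'.head? = some .NE)
    (h : List.replicate m PStep.E ++ l = List.replicate m' .E ++ l') : m = m' ∧ l = l' := by
  induction m generalizing m' with
  | zero =>
    cases m' with
    | zero => exact ⟨rfl, by simpa using h⟩
    | succ m' =>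
      obtain rfl : l = _ := h
      simp [List.replicate_succ] at hl
  | succ m ih =>
    cases m' with
    | zero =>
      obtain rfl : _ = l' := h
      simp [List.replicate_succ] at hl'
    | succ m' =>
      simp only [List.replicate_succ, List.cons_append, List.cons.injEq, true_and] at h
      obtain ⟨rfl, rfl⟩ := ih h
      exact ⟨rfl, rfl⟩

/-- A nonempty path from the origin is a run of East steps followed by a path beginning
with a North-East step. -/
noncomputable def eastRunEquiv (k N : ℕ) :
    ℕ × risingPaths k 0 (N + 1) ≃ pathsWithPeaks k 0 (N + 1) :=
  Equiv.ofBijective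
    (fun x => ⟨List.replicate x.1 .E ++ x.2.1,
      (walk_replicate_E (ne_nil_of_mem_risingPaths x.2.2)).2 x.2.2.1.1,
      (numPeaks_replicate_E _ _).trans x.2.2.1.2⟩) <| by
    constructor
    · rintro ⟨m, l, hl⟩ ⟨m', l', hl'⟩ h
      obtain ⟨rfl, rfl⟩ := replicate_E_append_injective hl.2 hl'.2 (Subtype.ext_iff.1 h)
      rfl
    · rintro ⟨l, H, hN⟩
      have hl : l ≠ [] := by
        rintro rfl
        simp [numPeaks] at hN
      obtain ⟨m, l', rfl, h1, h2⟩ := exists_replicate_E hl H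
      rw [numPeaks_replicate_E] at hN
      exact ⟨⟨m, l', ⟨h1, hN⟩, h2⟩, rfl⟩

end Decomposition

section QSeries

/-- The reciprocal `1 / (q;q)_m`, extended by zero to negative `m`. -/
noncomputable def qPochInv (q : ℂ) (m : ℤ) : ℂ :=
  if m < 0 then 0 else (qPochN q q m.toNat)⁻¹

lemma one_sub_pow_ne_zero {q : ℂ} (hq1 : ‖q‖ < 1) (n : ℕ) : 1 - q ^ (n + 1) ≠ 0 := by
  intro h
  have h1 : ‖q ^ (n + 1)‖ < 1 := by
    rw [norm_pow]
    exact pow_lt_one₀ (norm_nonneg _) hq1 (by omega)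
  rw [← sub_eq_zero.1 h] at h1
  simp at h1

lemma qPochInv_sub_one {q : ℂ} (hq1 : ‖q‖ < 1) (m : ℤ) :
    qPochInv q (m - 1) = (1 - q ^ m) * qPochInv q m := by
  rcases lt_trichotomy m 0 with hm | rfl | hm
  · simp [qPochInv, hm, show m - 1 < 0 by omega]
  · simp [qPochInv]
  · obtain ⟨n, rfl⟩ : ∃ n : ℕ, m = n + 1 := ⟨(m - 1).toNat, by omega⟩
    have h1 : ¬ ((n : ℤ) + 1 < 0) := by omega
    have h2 : ((n : ℤ) + 1).toNat = n + 1 := by omega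
    have h3 : q ^ ((n : ℤ) + 1) = q ^ (n + 1) := by exact_mod_cast zpow_natCast q (n + 1)
    have h4 := one_sub_pow_ne_zero hq1 n
    simp only [qPochInv, add_sub_cancel_right, h1, h2, h3, if_false]
    simp only [qPochN, Finset.prod_range_succ, ← pow_succ', mul_inv, Int.toNat_natCast]
    rw [if_neg (by omega), mul_comm _ (1 - q ^ (n + 1))⁻¹, mul_inv_cancel_left₀ h4]

/-- The signed power of `q` in the closed forms. -/
noncomputable def signedPower (q : ℂ) (k h n : ℤ) : ℂ :=
  (-1) ^ n * q ^ (k * n ^ 2 + n * h - n * (n - 1) / 2)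

lemma signedPower_succ {q : ℂ} (hq : q ≠ 0) (k h n : ℤ) :
    signedPower q k (h + 1) n = q ^ n * signedPower q k h n := by
  rw [signedPower, signedPower, mul_left_comm, ← zpow_add₀ hq]
  congr 2
  ring

lemma signedPower_neg (q : ℂ) (k n : ℤ) :
    signedPower q k 0 (-n) = signedPower q k (-1) n := by
  have h : -n * (-n - 1) / 2 = n * (n - 1) / 2 + n := by
    rw [show -n * (-n - 1) = n * (n - 1) + n * 2 by ring, Int.add_mul_ediv_right _ _ (by norm_num)]
  rw [signedPower, signedPower, h, zpow_neg, ← inv_zpow, inv_neg_one]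
  congr 2
  ring

lemma signedPower_reflect (q : ℂ) (k n : ℤ) :
    signedPower q k (k - 1) (-1 - n) = -signedPower q k (k - 1) n := by
  have h : (-1 - n) * (-1 - n - 1) / 2 = n * (n - 1) / 2 + (2 * n + 1) := by
    rw [show (-1 - n) * (-1 - n - 1) = n * (n - 1) + (2 * n + 1) * 2 by ring,
      Int.add_mul_ediv_right _ _ (by norm_num)]
  have hs : (-1 : ℂ) ^ (-1 - n) = -(-1) ^ n := by
    rw [zpow_sub₀ (by norm_num), ← inv_zpow' (-1 : ℂ) 1, ← one_div_mul_eq_div, one_div,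
      ← inv_zpow, inv_neg_one]
    simp
  rw [signedPower, signedPower, h, hs, neg_mul]
  congr 3
  ring

/-- The sum in the closed form for all paths. -/
noncomputable def pathSum (q : ℂ) (k h : ℤ) (N : ℕ) : ℂ :=
  ∑ n ∈ Finset.Icc (-(N : ℤ)) N, signedPower q k h n * (qPochInv q (N - n) * qPochInv q (N + n))

/-- The sum in the closed form for paths beginning with a North-East step. -/
noncomputable def risingSum (q : ℂ) (k h : ℤ) (N : ℕ) : ℂ :=
  ∑ n ∈ Finset.Icc (-(N : ℤ)) N,
    signedPower q k h n * (qPochInv q (N - n - 1) * qPochInv q (N + n))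

lemma pathSum_zero (q : ℂ) (k h : ℤ) : pathSum q k h 0 = 1 := by
  simp [pathSum, signedPower, qPochInv, qPochN]

lemma risingSum_zero (q : ℂ) (k h : ℤ) : risingSum q k h 0 = 0 := by
  simp [risingSum, qPochInv]

lemma risingSum_eq_sum (q : ℂ) (k h : ℤ) (N : ℕ) :
    risingSum q k h N = ∑ n ∈ Finset.Icc (-(N : ℤ)) (N - 1),
      signedPower q k h n * (qPochInv q (N - n - 1) * qPochInv q (N + n)) := by
  symm
  refine Finset.sum_subset (Finset.Icc_subset_Icc le_rfl (by omega)) fun n hn hn' => ?_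
  rw [Finset.mem_Icc] at hn hn'
  obtain rfl : n = N := by omega
  simp [qPochInv]

lemma pathSum_succ {q : ℂ} (hq : q ≠ 0) (hq1 : ‖q‖ < 1) (k h : ℤ) (N : ℕ) :
    pathSum q k (h + 1) N = q ^ N * pathSum q k h N + risingSum q k (h + 1) N := by
  rw [pathSum, pathSum, risingSum, Finset.mul_sum, ← Finset.sum_add_distrib]
  refine Finset.sum_congr rfl fun n _ => ?_
  have hn : q ^ N = q ^ ((N : ℤ) - n) * q ^ n := by
    rw [← zpow_add₀ hq, sub_add_cancel, zpow_natCast]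
  rw [qPochInv_sub_one hq1, signedPower_succ hq, hn]
  ring

lemma risingSum_succ {q : ℂ} (hq : q ≠ 0) (hq1 : ‖q‖ < 1) (k h : ℤ) (N : ℕ) :
    risingSum q k h (N + 1) = q ^ (N + 1) * risingSum q k (h + 1) (N + 1) + pathSum q k h N := by
  have hext : pathSum q k h N = ∑ n ∈ Finset.Icc (-((N + 1 : ℕ) : ℤ)) (N + 1 : ℕ),
      signedPower q k h n * (qPochInv q (N - n) * qPochInv q (N + n)) := by
    refine Finset.sum_subset (Finset.Icc_subset_Icc (by omega) (by omega)) fun n hn hn' => ?_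
    rw [Finset.mem_Icc] at hn hn'
    obtain rfl | rfl : n = N + 1 ∨ n = -(N + 1) := by omega
    · simp [qPochInv]
    · simp [qPochInv]
  rw [hext, risingSum, risingSum, Finset.mul_sum, ← Finset.sum_add_distrib]
  refine Finset.sum_congr rfl fun n _ => ?_
  have hn : q ^ ((N : ℤ) + 1 + n) = q ^ (N + 1) * q ^ n := by
    rw [zpow_add₀ hq]
    congr 1
  have h1 := qPochInv_sub_one hq1 ((N : ℤ) + 1 + n)
  rw [show (N : ℤ) + 1 + n - 1 = N + n by ring, hn] at h1
  rw [signedPower_succ hq, h1, show ((N + 1 : ℕ) : ℤ) - n - 1 = N - n by push_cast; ring]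
  push_cast
  ring

lemma pathSum_neg_one (q : ℂ) (k : ℤ) (N : ℕ) : pathSum q k (-1) N = pathSum q k 0 N := by
  refine Finset.sum_nbij' (fun n => -n) (fun n => -n) ?_ ?_ ?_ ?_ ?_
  · intro n hn; simp only [Finset.mem_Icc] at *; omega
  · intro n hn; simp only [Finset.mem_Icc] at *; omega
  · simp
  · simp
  · intro n _
    rw [signedPower_neg, sub_neg_eq_add, ← sub_eq_add_neg, mul_comm (qPochInv q (N + n))]

lemma pathSum_bottom {q : ℂ} (hq : q ≠ 0) (hq1 : ‖q‖ < 1) (k : ℤ) (N : ℕ) :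
    (1 - q ^ N) * pathSum q k 0 N = risingSum q k 0 N := by
  have h := pathSum_succ hq hq1 k (-1) N
  rw [neg_add_cancel, pathSum_neg_one] at h
  linear_combination h

lemma risingSum_top (q : ℂ) (k : ℤ) (N : ℕ) : risingSum q k (k - 1) N = 0 := by
  have h : risingSum q k (k - 1) N = -risingSum q k (k - 1) N := by
    conv_rhs => rw [risingSum_eq_sum, ← Finset.sum_neg_distrib]
    rw [risingSum_eq_sum]
    refine Finset.sum_nbij' (fun n => -1 - n) (fun n => -1 - n) ?_ ?_ ?_ ?_ ?_
    · intro n hn; simp only [Finset.mem_Icc] at *; omega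
    · intro n hn; simp only [Finset.mem_Icc] at *; omega
    · simp
    · simp
    · intro n _
      rw [signedPower_reflect, neg_mul, neg_neg, mul_comm (qPochInv q (N - (-1 - n) - 1)),
        show (N : ℤ) + (-1 - n) = N - n - 1 by ring, show (N : ℤ) - (-1 - n) - 1 = N + n by ring]
  exact self_eq_neg.1 h

/-- The common prefactor of the closed forms, in product form. -/
noncomputable def prefactor (q a : ℂ) (N : ℕ) : ℂ :=
  ∏ j ∈ Finset.range N, q ^ (j + 1) * (a + q ^ j)

lemma prefactor_succ (q a : ℂ) (N : ℕ) :
    prefactor q a (N + 1) = prefactor q a N * (q ^ (N + 1) * (a + q ^ N)) :=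
  Finset.prod_range_succ _ _

lemma prefactor_eq {q a : ℂ} (ha : a ≠ 0) (N : ℕ) :
    a ^ N * q ^ (N * (N + 1) / 2) * qPochN (-(1 / a)) q N = prefactor q a N := by
  induction N with
  | zero => simp [prefactor, qPochN]
  | succ N ih =>
    have h : (N + 1) * (N + 1 + 1) / 2 = N * (N + 1) / 2 + (N + 1) := by
      rw [show (N + 1) * (N + 1 + 1) = N * (N + 1) + (N + 1) * 2 by ring,
        Nat.add_mul_div_right _ _ (by norm_num)]
    rw [prefactor_succ, ← ih, h, qPochN, qPochN, Finset.prod_range_succ]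
    field_simp
    ring

lemma prefactor_eq_rising {q a : ℂ} (ha : a ≠ 0) (N : ℕ) :
    q ^ N * (a ^ N * q ^ (N * (N - 1) / 2) * qPochN (-(1 / a)) q N) = prefactor q a N := by
  have h : N * (N + 1) / 2 = N * (N - 1) / 2 + N := by
    rcases N with _ | N
    · rfl
    · rw [show (N + 1) * (N + 1 + 1) = (N + 1) * (N + 1 - 1) + (N + 1) * 2 by
        rw [Nat.add_sub_cancel]; ring, Nat.add_mul_div_right _ _ (by norm_num)]
  rw [← prefactor_eq ha, h]
  ring

end QSeries

section Summation

/-- The weight of a path in the generating functions. -/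
noncomputable def weight (q a : ℂ) (l : List PStep) : ℂ := q ^ majorIndex l * a ^ southSteps l

lemma hasSum_image_of_weight {q a c x : ℂ} {s : Set (List PStep)} {f : List PStep → List PStep}
    (hf : Function.Injective f) (hc : ∀ l ∈ s, weight q a (f l) = c * weight q a l)
    (H : HasSum (weight q a ∘ ((↑) : s → List PStep)) x) :
    HasSum (weight q a ∘ ((↑) : f '' s → List PStep)) (c * x) := by
  rw [← (Equiv.Set.image f s hf).hasSum_iff]
  have h : (weight q a ∘ ((↑) : f '' s → List PStep)) ∘ Equiv.Set.image f s hf =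
      fun l => c * (weight q a ∘ ((↑) : s → List PStep)) l := funext fun l => hc l l.2
  rw [h]
  exact H.mul_left c

lemma hasSum_risingPaths_succ {q a x y : ℂ} {k h N : ℕ} (hk : h + 1 < k)
    (hx : HasSum (weight q a ∘ ((↑) : risingPaths k (h + 1) (N + 1) → List PStep)) x)
    (hy : HasSum (weight q a ∘ ((↑) : pathsWithPeaks k h N → List PStep)) y) :
    HasSum (weight q a ∘ ((↑) : risingPaths k h (N + 1) → List PStep))
      (q ^ (N + 1) * x + q ^ (N + 1) * (a + q ^ N) * y) := by
  have h1 := hasSum_image_of_weight (f := List.cons .NE) (c := q ^ (N + 1))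
    List.cons_injective (fun l hl => by
      obtain ⟨⟨-, hN⟩, hl⟩ := hl
      rcases l with _ | ⟨s, l⟩
      · simp at hl
      obtain rfl : s = .NE := by simpa using hl
      rw [weight, weight, majorIndex_cons _ (.NE :: l), hN]
      simp [IsPeak, stepDx, southSteps_cons]
      ring) hx
  have h2 := hasSum_image_of_weight (f := fun l => .NE :: .SE :: l) (c := q ^ (N + 1) * q ^ N)
    (fun l l' h => by simpa using h) (fun l hl => by
      rw [weight, weight, majorIndex_cons, majorIndex_cons, numPeaks_cons, hl.2]
      simp [IsPeak, stepDx, southSteps_cons]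
      ring) hy
  have h3 := hasSum_image_of_weight (f := fun l => .NE :: .S :: l) (c := q ^ (N + 1) * a)
    (fun l l' h => by simpa using h) (fun l hl => by
      rw [weight, weight, majorIndex_cons, majorIndex_cons, numPeaks_cons, hl.2]
      simp [IsPeak, stepDx, southSteps_cons]
      ring) hy
  rw [risingPaths_succ hk]
  convert HasSum.add_disjoint ?_ (HasSum.add_disjoint ?_ h1 h2) h3 using 1
  · ring
  · rw [Set.disjoint_left]
    rintro _ (⟨l, hl, rfl⟩ | ⟨l, hl, rfl⟩) ⟨l', hl', h⟩
    · obtain rfl : _ = l := by simpa using h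
      simpa using hl.2
    · simp at h
  · rw [Set.disjoint_left]
    rintro _ ⟨l, hl, rfl⟩ ⟨l', hl', h⟩
    obtain rfl : _ = l := by simpa using h
    simpa using hl.2

lemma hasSum_pathsWithPeaks_succ {q a x y : ℂ} {k h N : ℕ} (hk : h + 1 < k)
    (hx : HasSum (weight q a ∘ ((↑) : pathsWithPeaks k h N → List PStep)) x)
    (hy : HasSum (weight q a ∘ ((↑) : risingPaths k (h + 1) N → List PStep)) y) :
    HasSum (weight q a ∘ ((↑) : pathsWithPeaks k (h + 1) N → List PStep)) (q ^ N * x + y) := by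
  have h1 := hasSum_image_of_weight (f := List.cons .SE) (c := q ^ N)
    List.cons_injective (fun l hl => by
      rw [weight, weight, majorIndex_cons, hl.2]
      simp [IsPeak, stepDx, southSteps_cons]
      ring) hx
  rw [pathsWithPeaks_succ hk]
  refine HasSum.add_disjoint ?_ h1 hy
  rw [Set.disjoint_left]
  rintro _ ⟨l, -, rfl⟩ hl
  simpa using hl.2

lemma weight_replicate_E (q a : ℂ) (m : ℕ) (l : List PStep) :
    weight q a (List.replicate m .E ++ l) = (q ^ numPeaks l) ^ m * weight q a l := by
  induction m with
  | zero => simp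
  | succ m ih =>
    rw [List.replicate_succ, List.cons_append, pow_succ', mul_assoc, ← ih, weight, weight,
      majorIndex_cons, numPeaks_replicate_E]
    simp [IsPeak, stepDx, southSteps_cons]
    ring

lemma hasSum_pathsWithPeaks_bottom {q a x : ℂ} (hq1 : ‖q‖ < 1) {k N : ℕ}
    (hx : HasSum (weight q a ∘ ((↑) : risingPaths k 0 (N + 1) → List PStep)) x) :
    HasSum (weight q a ∘ ((↑) : pathsWithPeaks k 0 (N + 1) → List PStep))
      ((1 - q ^ (N + 1))⁻¹ * x) := by
  have hq : ‖q ^ (N + 1)‖ < 1 := by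
    rw [norm_pow]
    exact pow_lt_one₀ (norm_nonneg _) hq1 (by omega)
  have hgeo := hasSum_geometric_of_norm_lt_one hq
  rw [← (eastRunEquiv k N).hasSum_iff]
  have h : (weight q a ∘ ((↑) : pathsWithPeaks k 0 (N + 1) → List PStep)) ∘ eastRunEquiv k N =
      fun p => (q ^ (N + 1)) ^ p.1 * (weight q a ∘ ((↑) : risingPaths k 0 (N + 1) → _)) p.2 := by
    funext p
    have hp := weight_replicate_E q a p.1 p.2.1
    rw [p.2.2.1.2] at hp
    exact hp
  rw [h]
  exact hgeo.mul hx (summable_mul_of_summable_norm hgeo.summable.norm hx.summable.norm)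

lemma hasSum_risingPaths_of_pathsWithPeaks {q a : ℂ} (hq : q ≠ 0) (hq1 : ‖q‖ < 1) {k N : ℕ}
    (hE : ∀ h < k, HasSum (weight q a ∘ ((↑) : pathsWithPeaks k h N → List PStep))
      (prefactor q a N * pathSum q k h N)) {h : ℕ} (hh : h < k) :
    HasSum (weight q a ∘ ((↑) : risingPaths k h (N + 1) → List PStep))
      (prefactor q a (N + 1) * risingSum q k h (N + 1)) := by
  obtain ⟨k, rfl⟩ : ∃ k', k = k' + 1 := ⟨k - 1, by omega⟩
  induction Nat.le_of_lt_succ hh using Nat.decreasingInduction with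
  | self =>
    rw [risingPaths_top]
    have h0 := risingSum_top q (k + 1 : ℕ) (N + 1)
    rw [Nat.cast_succ, add_sub_cancel_right] at h0
    rw [Nat.cast_succ, h0, mul_zero]
    exact hasSum_empty
  | of_succ h hlt ih =>
    convert hasSum_risingPaths_succ (by omega) (ih (by omega)) (hE h (by omega)) using 1
    rw [risingSum_succ hq hq1, prefactor_succ]
    push_cast
    ring

lemma hasSum_pathsWithPeaks {q a : ℂ} (hq : q ≠ 0) (hq1 : ‖q‖ < 1) {k : ℕ} (N : ℕ) :
    ∀ h < k, HasSum (weight q a ∘ ((↑) : pathsWithPeaks k h N → List PStep))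
      (prefactor q a N * pathSum q k h N) := by
  induction N with
  | zero =>
    intro h hh
    induction h with
    | zero =>
      rw [pathsWithPeaks_zero_zero hh]
      convert hasSum_unique (weight q a ∘ ((↑) : ({[]} : Set (List PStep)) → List PStep)) using 1
      simp [pathSum_zero, prefactor, weight, majorIndex, southSteps]
    | succ h ih =>
      convert hasSum_pathsWithPeaks_succ hh (ih (by omega)) (y := 0)
        (by rw [risingPaths_zero]; exact hasSum_empty) using 1
      simp [pathSum_zero]
  | succ N hE =>
    have hG := fun h (hh : h < k) => hasSum_risingPaths_of_pathsWithPeaks hq hq1 hE hh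
    intro h hh
    induction h with
    | zero =>
      convert hasSum_pathsWithPeaks_bottom hq1 (hG 0 hh) using 1
      rw [Nat.cast_zero, ← pathSum_bottom hq hq1]
      field_simp [one_sub_pow_ne_zero hq1 N]
    | succ h ih =>
      convert hasSum_pathsWithPeaks_succ hh (ih (by omega)) (hG _ hh) using 1
      push_cast
      rw [pathSum_succ hq hq1]
      ring

lemma hasSum_risingPaths {q a : ℂ} (hq : q ≠ 0) (hq1 : ‖q‖ < 1) {k h : ℕ} (N : ℕ) (hh : h < k) :
    HasSum (weight q a ∘ ((↑) : risingPaths k h N → List PStep))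
      (prefactor q a N * risingSum q k h N) := by
  cases N with
  | zero =>
    rw [risingPaths_zero, risingSum_zero, mul_zero]
    exact hasSum_empty
  | succ N => exact hasSum_risingPaths_of_pathsWithPeaks hq hq1 (hasSum_pathsWithPeaks hq hq1 N) hh

lemma numPeaks_le_majorIndex_of_mem_risingPaths {k h N : ℕ} {l : List PStep}
    (hl : l ∈ risingPaths k h N) : N ≤ majorIndex l := by
  obtain ⟨⟨-, rfl⟩, hl⟩ := hl
  rcases l with _ | ⟨s, l⟩
  · simp at hl
  · obtain rfl : s = .NE := by simpa using hl
    exact numPeaks_le_majorIndex l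

lemma tsum_card_fiber {α β : Type*} {f : α → β} {c : β → ℂ} {x : ℂ}
    (H : HasSum (fun y => c (f y)) x) : ∑' b, (Nat.card {y // f y = b} : ℂ) * c b = x := by
  rw [← (H.tsum_fiberwise f).tsum_eq]
  refine tsum_congr fun b => ?_
  have : ∀ y : f ⁻¹' {b}, c (f y) = c b := fun y => by rw [show f y = b from y.2]
  rw [tsum_congr this, tsum_const, nsmul_eq_mul]
  rfl

end Summation

/-- **Theorem 3.2.** Closed forms for the generating functions `Ē_{k,i}(N)` (when
`1 ≤ i ≤ k`) and `Γ̄_{k,i}(N)` (when `0 ≤ i < k`). -/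
theorem path_gen_fun_closed_form (k i N : ℕ) (hik : i ≤ k) (a q : ℂ)
    (hq0 : 0 < ‖q‖) (hq1 : ‖q‖ < 1) (ha : a ≠ 0) :
    (1 ≤ i →
      ∑' p : ℕ × ℕ, (EbarP k i p.1 p.2 N : ℂ) * q ^ p.1 * a ^ p.2 =
        a ^ N * q ^ (N * (N + 1) / 2) * qPochN (-(1 / a)) q N *
          ∑ n ∈ Finset.Icc (-(N : ℤ)) (N : ℤ), (-1 : ℂ) ^ n *
            q ^ ((k : ℤ) * n ^ 2 + n * ((k : ℤ) - (i : ℤ)) - n * (n - 1) / 2) /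
              (qPochN q q ((N : ℤ) - n).toNat * qPochN q q ((N : ℤ) + n).toNat)) ∧
    (i < k →
      ∑' p : ℕ × ℕ, (GbarP k i p.1 p.2 N : ℂ) * q ^ p.1 * a ^ p.2 =
        a ^ N * q ^ (N * (N - 1) / 2) * qPochN (-(1 / a)) q N *
          ∑ n ∈ Finset.Icc (-(N : ℤ)) ((N : ℤ) - 1), (-1 : ℂ) ^ n *
            q ^ ((k : ℤ) * n ^ 2 + n * ((k : ℤ) - (i : ℤ)) - n * (n + 1) / 2) /
              (qPochN q q ((N : ℤ) - n - 1).toNat * qPochN q q ((N : ℤ) + n).toNat)) := by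
  have hq : q ≠ 0 := norm_pos_iff.1 hq0
  refine ⟨fun hi => ?_, fun hi => ?_⟩
  · have hcast : ((k - i : ℕ) : ℤ) = k - i := by omega
    have H := hasSum_pathsWithPeaks (a := a) hq hq1 N (k - i) (k := k) (by omega)
    have key := tsum_card_fiber (f := fun l : pathsWithPeaks k (k - i) N =>
      (majorIndex l.1, southSteps l.1)) (c := fun p => q ^ p.1 * a ^ p.2) H
    rw [prefactor_eq ha]
    convert key using 1
    · refine tsum_congr fun p => ?_
      rw [mul_assoc]
      congr 2
      refine Nat.card_congr ((Equiv.subtypeSubtypeEquivSubtypeInter (· ∈ pathsWithPeaks k (k - i) N)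
        fun l => (majorIndex l, southSteps l) = p).trans (Equiv.subtypeEquivRight fun l => ?_)).symm
      rw [specialPath_iff, Prod.ext_iff]
      simp only [pathsWithPeaks, Set.mem_ofPred_eq]
      tauto
    · congr 1
      refine Finset.sum_congr rfl fun n hn => ?_
      rw [Finset.mem_Icc] at hn
      rw [hcast, signedPower, qPochInv, qPochInv, if_neg (by omega), if_neg (by omega),
        div_eq_mul_inv, mul_inv]
  · have hcast : ((k - (i + 1) : ℕ) : ℤ) = k - i - 1 := by omega
    have H := hasSum_risingPaths (a := a) (k := k) (h := k - (i + 1)) hq hq1 N (by omega)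
    have hN : ∀ l : risingPaths k (k - (i + 1)) N, N ≤ majorIndex l.1 := fun l =>
      numPeaks_le_majorIndex_of_mem_risingPaths l.2
    have hfun : (fun l : risingPaths k (k - (i + 1)) N =>
        q ^ (majorIndex l.1 - N) * a ^ southSteps l.1) = fun l => (q ^ N)⁻¹ * weight q a l.1 := by
      funext l
      rw [weight, pow_sub₀ q hq (hN l)]
      ring
    have key := tsum_card_fiber (f := fun l : risingPaths k (k - (i + 1)) N =>
      (majorIndex l.1 - N, southSteps l.1)) (c := fun p => q ^ p.1 * a ^ p.2)
      (x := (q ^ N)⁻¹ * (prefactor q a N * risingSum q k (k - (i + 1) : ℕ) N))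
      (by simp only [hfun]; exact H.mul_left _)
    rw [← prefactor_eq_rising ha, mul_assoc, inv_mul_cancel_left₀ (pow_ne_zero _ hq)] at key
    convert key using 1
    · refine tsum_congr fun p => ?_
      rw [mul_assoc]
      congr 2
      refine Nat.card_congr ((Equiv.subtypeEquivRight fun l => ?_).trans
        (Equiv.subtypeSubtypeEquivSubtypeExists (· ∈ risingPaths k (k - (i + 1)) N)
          fun l => (majorIndex l.1 - N, southSteps l.1) = p).symm)
      rw [specialPath_iff]
      constructor
      · rintro ⟨h1, h2, h3, h4, h5⟩
        exact ⟨⟨⟨h1, h2⟩, h3⟩, Prod.ext (by simp [h4]) h5⟩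
      · rintro ⟨hl, rfl⟩
        exact ⟨hl.1.1, hl.1.2, hl.2, (Nat.sub_add_cancel (hN ⟨l, hl⟩)).symm, rfl⟩
    · rw [risingSum_eq_sum]
      congr 1
      refine Finset.sum_congr rfl fun n hn => ?_
      rw [Finset.mem_Icc] at hn
      have hexp : (k : ℤ) * n ^ 2 + n * (k - i) - n * (n + 1) / 2 =
          k * n ^ 2 + n * (k - i - 1) - n * (n - 1) / 2 := by
        rw [show n * (n + 1) = n * (n - 1) + n * 2 by ring,
          Int.add_mul_ediv_right _ _ (by norm_num)]
        ring
      rw [hcast, signedPower, qPochInv, qPochInv, if_neg (by omega), if_neg (by omega),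
        div_eq_mul_inv, mul_inv, hexp]

end Paper
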